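/- Let R be a commutative Noetherian ring, 𝔞 an ideal of R, and M a nonzero finitely generated Cohen–Macaulay R-module (i.e. for every 𝔭 ∈ Supp_R(M), the R_𝔭-module M_𝔭 satisfies depth M_𝔭 = dim M_𝔭). If 0 < ht_M(𝔞) < ∞, then f_𝔞(M) = grade(𝔞,M); that is, H^i_𝔞(M) is finitely generated for all i < grade(𝔞,M) and H^{grade(𝔞,M)}_𝔞(M) is not finitely generated. -/

import Mathlib

/-!
STATEMENT 5: Let R be a commutative Noetherian ring, 𝔞 an ideal of R, and M a nonzero finitely
generated Cohen–Macaulay R-module (i.e. for every 𝔭 ∈ Supp_R(M), depth M_𝔭 = dim M_𝔭).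
If 0 < ht_M(𝔞) < ∞, then f_𝔞(M) = grade(𝔞,M); that is, H^i_𝔞(M) is finitely generated for all
i < grade(𝔞,M) and H^{grade(𝔞,M)}_𝔞(M) is not finitely generated.

Here depth M_𝔭 := inf{ i : Ext^i_{R_𝔭}(R_𝔭/𝔭R_𝔭, M_𝔭) ≠ 0 } (an element of ℕ∞), dim M_𝔭 is
the Krull dimension of the support of M_𝔭, ht_M(𝔞) := inf{ dim M_𝔭 : 𝔭 ∈ Supp M ∩ V(𝔞) }, and
`g = grade(𝔞,M)` is encoded by: `Ext^g_R(R/𝔞,M)` is nontrivial and `Ext^i_R(R/𝔞,M)` is trivial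
for `i < g`.
-/

open CategoryTheory Opposite

universe u

/-- The Krull dimension of an `R`-module `M`, i.e. the Krull dimension of its support. -/
noncomputable def moduleKrullDim (R : Type u) [CommRing R]
    (M : Type u) [AddCommGroup M] [Module R M] : WithBot ℕ∞ :=
  Order.krullDim ↥(Module.support R M)

/-- The depth of a module `M` over a commutative local ring `R`:
`inf{ i : Ext^i_R(R/𝔪, M) ≠ 0 }`, as an element of `ℕ∞`. -/
noncomputable def moduleDepth (R : Type u) [CommRing R] [IsLocalRing R]
    (M : Type u) [AddCommGroup M] [Module R M] : ℕ∞ :=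
  sInf { d : ℕ∞ | ∃ i : ℕ, d = i ∧ Nontrivial
    (((Ext R (ModuleCat.{u} R) i).obj
      (op (ModuleCat.of R (R ⧸ IsLocalRing.maximalIdeal R)))).obj (ModuleCat.of R M)) }

/-- `ht_M(𝔞) = inf { dim_{R_𝔭} M_𝔭 : 𝔭 ∈ Supp M ∩ V(𝔞) }`. -/
noncomputable def moduleHeight (R : Type u) [CommRing R]
    (M : Type u) [AddCommGroup M] [Module R M] (𝔞 : Ideal R) : WithBot ℕ∞ :=
  sInf { d : WithBot ℕ∞ | ∃ 𝔭 ∈ Module.support R M, 𝔞 ≤ 𝔭.asIdeal ∧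
    d = moduleKrullDim (Localization.AtPrime 𝔭.asIdeal) (LocalizedModule 𝔭.asIdeal.primeCompl M) }

noncomputable section

open Limits

namespace CategoryTheory.ProjectiveResolution
variable {R : Type u} [CommRing R] {X X' Y : ModuleCat.{u} R}

/-- The morphism of cochain complexes `Hom(Q, Y) ⟶ Hom(P, Y)` induced by a chain map `P ⟶ Q`. -/
def linearYonedaMap {P : ProjectiveResolution X} {Q : ProjectiveResolution X'}
    (φ : P.complex ⟶ Q.complex) (Y : ModuleCat.{u} R) :
    Q.complex.linearYonedaObj R Y ⟶ P.complex.linearYonedaObj R Y :=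
  (HomologicalComplex.unopFunctor (ModuleCat R) (ComplexShape.down ℕ)).map
    ((((linearYoneda R (ModuleCat.{u} R)).obj Y).rightOp.mapHomologicalComplex _).map φ).op

lemma isoExt_naturality (P : ProjectiveResolution X) (Q : ProjectiveResolution X') (g : X ⟶ X')
    (φ : Hom P Q g) (Y : ModuleCat.{u} R) (n : ℕ) :
    ((Ext R (ModuleCat.{u} R) n).map g.op).app Y ≫ (P.isoExt n Y).hom =
    (Q.isoExt n Y).hom ≫ HomologicalComplex.homologyMap (linearYonedaMap φ.hom Y) n := by
  have h1 := isoLeftDerivedObj_inv_naturality g P Q φ.hom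
    (by simpa using! φ.hom_f_zero_comp_π_f_zero)
    ((linearYoneda R (ModuleCat.{u} R)).obj Y).rightOp n
  have h2 := HomologicalComplex.homologyOp_hom_naturality (linearYonedaMap φ.hom Y) n
  have h3 := congrArg Quiver.Hom.unop h1
  have h4 := congrArg Quiver.Hom.unop
    ((Iso.eq_comp_inv _).mpr ((Category.assoc _ _ _).trans ((Iso.inv_comp_eq _).mpr h2)))
  have key : ∀ {A A' B B' D D' : ModuleCat.{u} R} {a : A ⟶ A'} {p : A' ⟶ B'} {q : A ⟶ B}
      {b : B ⟶ B'} {c : B' ⟶ D'} {d : B ⟶ D} {m : D ⟶ D'}, a ≫ p = q ≫ b → b ≫ c = d ≫ m →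
      a ≫ p ≫ c = (q ≫ d) ≫ m := by
    intro _ _ _ _ _ _ a p q b c d m h h'
    rw [reassoc_of% h, h', Category.assoc]
  exact key h3 h4

lemma smul_extMk (P : ProjectiveResolution X) {n : ℕ} (f : P.complex.X n ⟶ Y) (m : ℕ)
    (hm : n + 1 = m) (hf : P.complex.d m n ≫ f = 0) (r : R) :
    r • P.extMk f m hm hf = P.extMk (r • f) m hm (by simp [hf]) := by
  rw [Abelian.Ext.smul_eq_comp_mk₀, extMk_comp_mk₀]
  congr 1

lemma eq_zero_of_extMk_eq_zero (P : ProjectiveResolution X) (f : P.complex.X 0 ⟶ Y) (m : ℕ)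
    (hm : 0 + 1 = m) (hf : P.complex.d m 0 ≫ f = 0) (h : P.extMk f m hm hf = 0) : f = 0 := by
  rw [← P.extEquivCohomologyClass.apply_eq_iff_eq,
    extEquivCohomologyClass_extMk, extEquivCohomologyClass_zero,
    CochainComplex.HomComplex.CohomologyClass.mk_eq_zero_iff,
    CochainComplex.HomComplex.Cocycle.toSingleMk_mem_coboundaries_iff _ _ _ _ _ 1 (by simp)] at h
  obtain ⟨g, hg⟩ := h
  have : Limits.IsZero (P.cochainComplex.X 1) := P.cochainComplex.isZero_of_isStrictlyLE 0 1
  rw [this.eq_of_src g 0, Limits.comp_zero] at hg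
  rw [← cancel_epi (P.cochainComplexXIso (-(0 : ℕ)) 0 rfl).hom, ← hg, Limits.comp_zero]

/-- The morphism `P.complex.X n ⟶ Y` underlying a cocycle of `Hom(P, Y)`. -/
def cocycle (P : ProjectiveResolution X) (Y : ModuleCat.{u} R) (n : ℕ) :
    (P.complex.linearYonedaObj R Y).cycles n →ₗ[R] (P.complex.X n ⟶ Y) :=
  ((P.complex.linearYonedaObj R Y).iCycles n).hom

lemma d_comp_cocycle (P : ProjectiveResolution X) (Y : ModuleCat.{u} R) (n : ℕ)
    (z : (P.complex.linearYonedaObj R Y).cycles n) :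
    P.complex.d (n + 1) n ≫ P.cocycle Y n z = 0 :=
  congr($((P.complex.linearYonedaObj R Y).iCycles_d n (n + 1)) z)

/-- The class in `Ext` of a cocycle of `Hom(P, Y)`. -/
def cyclesToExt (P : ProjectiveResolution X) (Y : ModuleCat.{u} R) (n : ℕ) :
    (P.complex.linearYonedaObj R Y).cycles n →ₗ[R] Abelian.Ext X Y n where
  toFun z := P.extMk (P.cocycle Y n z) (n + 1) rfl (P.d_comp_cocycle Y n z)
  map_add' z w := by
    rw [add_extMk]
    congr 1
    exact map_add _ _ _
  map_smul' r z := by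
    dsimp
    rw [smul_extMk]
    congr 1
    exact map_smul _ _ _

lemma cyclesToExt_surjective (P : ProjectiveResolution X) (Y : ModuleCat.{u} R) (n : ℕ) :
    Function.Surjective (P.cyclesToExt Y n) := by
  intro α
  obtain ⟨f, hf, rfl⟩ := P.extMk_surjective α (n + 1) rfl
  let K := P.complex.linearYonedaObj R Y
  have hc : IsLimit (KernelFork.ofι _ (K.iCycles_d n (n + 1))) := K.cyclesIsKernel n (n+1) (by simp)
  have hE := ShortComplex.exact_of_f_is_kernel (.mk _ _ (K.iCycles_d n (n + 1))) hc
  obtain ⟨z, hz⟩ := (ShortComplex.moduleCat_exact_iff _).mp hE f hf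
  refine ⟨z, ?_⟩
  change P.extMk (P.cocycle Y n z) (n + 1) rfl (P.d_comp_cocycle Y n z) = _
  congr 1

lemma ker_cyclesToExt (P : ProjectiveResolution X) (Y : ModuleCat.{u} R) (n : ℕ) :
    LinearMap.ker (P.cyclesToExt Y n) =
      LinearMap.ker ((P.complex.linearYonedaObj R Y).homologyπ n).hom := by
  let K := P.complex.linearYonedaObj R Y
  have hE := ShortComplex.exact_of_g_is_cokernel
    (.mk _ _ (K.toCycles_comp_homologyπ ((ComplexShape.up ℕ).prev n) n))
     (K.homologyIsCokernel _ n rfl)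
  have hinj : Function.Injective (K.iCycles n) := (ModuleCat.mono_iff_injective _).mp inferInstance
  ext z
  rw [LinearMap.mem_ker, LinearMap.mem_ker]
  have key : (K.homologyπ n).hom z = 0 ↔
      ∃ w, K.d ((ComplexShape.up ℕ).prev n) n w = K.iCycles n z := by
    constructor
    · intro h
      obtain ⟨w, hw⟩ := (ShortComplex.moduleCat_exact_iff _).mp hE z h
      exact ⟨w, by rw [← hw, ← K.toCycles_i]; rfl⟩
    · rintro ⟨w, hw⟩
      have : K.toCycles ((ComplexShape.up ℕ).prev n) n w = z := by
        apply hinj; rw [← hw, ← K.toCycles_i]; rfl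
      rw [← this]
      exact congr($(K.toCycles_comp_homologyπ ((ComplexShape.up ℕ).prev n) n) w)
  refine Iff.trans ?_ key.symm
  change P.extMk (P.cocycle Y n z) (n + 1) rfl (P.d_comp_cocycle Y n z) = 0 ↔ _
  cases n with
  | zero =>
    have h0 : K.d ((ComplexShape.up ℕ).prev 0) 0 = 0 := K.shape _ _ (by simp)
    rw [h0]
    constructor
    · intro h
      exact ⟨0, (P.eq_zero_of_extMk_eq_zero _ _ _ _ h).symm⟩
    · rintro ⟨w, hw⟩
      have hw' : K.iCycles 0 z = 0 := hw.symm
      have : ∀ (f : P.complex.X 0 ⟶ Y) hf, f = 0 → P.extMk f 1 rfl hf = 0 := by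
        rintro _ _ rfl; simp
      exact this _ _ hw'
  | succ n =>
    rw [P.extMk_eq_zero_iff _ _ _ _ n rfl, CochainComplex.prev_nat_succ]
    rfl

/-- `Ext` defined as a left derived functor agrees with `Abelian.Ext`. -/
def extLinearEquiv (P : ProjectiveResolution X) (Y : ModuleCat.{u} R) (n : ℕ) :
    ((Ext R (ModuleCat.{u} R) n).obj (op X)).obj Y ≃ₗ[R] Abelian.Ext X Y n :=
  (P.isoExt n Y).toLinearEquiv ≪≫ₗ
  (LinearMap.quotKerEquivOfSurjective _ ((ModuleCat.epi_iff_surjective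
      ((P.complex.linearYonedaObj R Y).homologyπ n)).mp inferInstance)).symm ≪≫ₗ
  Submodule.quotEquivOfEq _ _ (P.ker_cyclesToExt Y n).symm ≪≫ₗ
  LinearMap.quotKerEquivOfSurjective _ (P.cyclesToExt_surjective Y n)

lemma extLinearEquiv_apply (P : ProjectiveResolution X) (Y : ModuleCat.{u} R) (n : ℕ) (α)
    (z : (P.complex.linearYonedaObj R Y).cycles n)
    (h : (P.isoExt n Y).hom α = (P.complex.linearYonedaObj R Y).homologyπ n z) :
    P.extLinearEquiv Y n α = P.cyclesToExt Y n z := by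
  have : (LinearMap.quotKerEquivOfSurjective _ ((ModuleCat.epi_iff_surjective
      ((P.complex.linearYonedaObj R Y).homologyπ n)).mp inferInstance)).symm
      ((P.isoExt n Y).hom α) = Submodule.Quotient.mk z := by
    rw [LinearEquiv.symm_apply_eq, h]; rfl
  simp only [extLinearEquiv, LinearEquiv.trans_apply]
  erw [this]
  rfl

lemma extLinearEquiv_naturality (P : ProjectiveResolution X) (Q : ProjectiveResolution X')
    (g : X ⟶ X') (Y : ModuleCat.{u} R) (n : ℕ) (α) :
    P.extLinearEquiv Y n (((Ext R (ModuleCat.{u} R) n).map g.op).app Y α) =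
      (Abelian.Ext.mk₀ g).comp (Q.extLinearEquiv Y n α) (zero_add n) := by
  let φ : Hom P Q g := ⟨lift g P Q, lift_commutes_zero g P Q⟩
  obtain ⟨z, hz⟩ := (ModuleCat.epi_iff_surjective
      ((Q.complex.linearYonedaObj R Y).homologyπ n)).mp inferInstance ((Q.isoExt n Y).hom α)
  rw [Q.extLinearEquiv_apply Y n α z hz.symm, P.extLinearEquiv_apply Y n _
    (HomologicalComplex.cyclesMap (linearYonedaMap φ.hom Y) n z)]
  · change P.extMk (P.cocycle Y n _) (n + 1) rfl (P.d_comp_cocycle Y n _) =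
      (Abelian.Ext.mk₀ g).comp (Q.extMk (Q.cocycle Y n z) (n + 1) rfl (Q.d_comp_cocycle Y n z)) _
    rw [mk₀_comp_extMk (φ := φ)]
    congr 1
    exact congr($(HomologicalComplex.cyclesMap_i (linearYonedaMap φ.hom Y) n) z)
  · have h1 := congr($(isoExt_naturality P Q g φ Y n) α)
    have h2 := congr($(HomologicalComplex.homologyπ_naturality (linearYonedaMap φ.hom Y) n) z)
    simp only [ConcreteCategory.comp_apply] at h1 h2
    rw [h1, ← hz, h2]

end CategoryTheory.ProjectiveResolution

end

section

open Abelian Limits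
open scoped Pointwise

variable {R : Type u} [CommRing R]

lemma Module.smul_top_lt_top_of_mem_support {M : Type*} [AddCommGroup M] [Module R M]
    [Module.Finite R M] {I : Ideal R} {p : PrimeSpectrum R} (hp : p ∈ Module.support R M)
    (hI : I ≤ p.asIdeal) : I • (⊤ : Submodule R M) < ⊤ := by
  refine lt_top_iff_ne_top.mpr fun h => ?_
  obtain ⟨r, hr, hr0⟩ := Submodule.exists_sub_one_mem_and_smul_eq_zero_of_fg_of_le_smul I
    (⊤ : Submodule R M) Module.Finite.fg_top h.ge
  have h1 : r ∈ p.asIdeal := Module.annihilator_le_of_mem_support hp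
    (Module.mem_annihilator.mpr fun m => hr0 m trivial)
  exact p.2.ne_top ((Ideal.eq_top_iff_one _).mpr (by simpa using sub_mem h1 (hI hr)))

namespace ModuleCat

lemma smul_ext_eq_zero_of_mem_annihilator {N M : ModuleCat.{u} R} {r : R}
    (hr : r ∈ Module.annihilator R N) {i : ℕ} (α : Ext N M i) : r • α = 0 := by
  have h : r • 𝟙 N = 0 := by
    simp [← ModuleCat.lsmul_eq_smul_id, Module.mem_annihilator_iff_lsmul_eq_zero.mp hr]
  calc r • α = (Ext.mk₀ (r • 𝟙 N)).comp α (zero_add i) := by simp [Ext.mk₀_smul]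
    _ = 0 := by simp [h]

lemma subsingleton_ext_of_support_subset [IsNoetherianRing R] {I : Ideal R} {n : ℕ}
    {M : ModuleCat.{u} R} [Module.Finite R M] (hM : I • (⊤ : Submodule R M) < ⊤)
    (h : ∀ i < n, Subsingleton (Ext (ModuleCat.of R (R ⧸ I)) M i))
    (N : ModuleCat.{u} R) [Module.Finite R N]
    (hN : Module.support R N ⊆ PrimeSpectrum.zeroLocus I) :
    ∀ i < n, Subsingleton (Ext N M i) := by
  have hs : Module.support R (ModuleCat.of R (R ⧸ I)) = PrimeSpectrum.zeroLocus I := by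
    rw [Module.support_eq_zeroLocus]
    exact congrArg _ (congrArg _ (Ideal.annihilator_quotient))
  obtain ⟨rs, rfl, hmem, hreg⟩ := exists_isRegular_of_exists_subsingleton_ext I n M hM
    (ModuleCat.of R (R ⧸ I)) hs h
  exact subsingleton_ext_of_exists_isRegular I N hN M hM rs hmem hreg

lemma support_quotient_pow_subset (I : Ideal R) (t : ℕ) :
    Module.support R (R ⧸ I ^ t) ⊆ PrimeSpectrum.zeroLocus I := by
  rw [Module.support_eq_zeroLocus, Ideal.annihilator_quotient]
  intro p hp
  exact Ideal.IsPrime.le_of_pow_le (n := t) hp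

lemma exists_isSMulRegular_of_subsingleton_ext_zero [IsNoetherianRing R] {I : Ideal R}
    {M : ModuleCat.{u} R} [Module.Finite R M]
    (h : Subsingleton (Ext (ModuleCat.of R (R ⧸ I)) M 0)) : ∃ x ∈ I, IsSMulRegular M x := by
  have : Subsingleton ((R ⧸ I) →ₗ[R] M) :=
    ((Ext.addEquiv₀ (X := ModuleCat.of R (R ⧸ I))).trans ModuleCat.homAddEquiv).symm.subsingleton
  obtain ⟨x, hx, hreg⟩ := IsSMulRegular.subsingleton_linearMap_iff.mp this
  exact ⟨x, by rwa [Ideal.annihilator_quotient] at hx, hreg⟩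

lemma subsingleton_ext_quotSMulTop {N M : ModuleCat.{u} R} {x : R} (hx : IsSMulRegular M x) {i : ℕ}
    (h : Subsingleton (Ext N M i)) (h' : Subsingleton (Ext N M (i + 1))) :
    Subsingleton (Ext N (ModuleCat.of R (QuotSMulTop x M)) i) := by
  refine subsingleton_of_forall_eq 0 fun α => ?_
  obtain ⟨β, rfl⟩ := Ext.covariant_sequence_exact₃ N hx.smulShortComplex_shortExact α rfl
    (h'.elim _ _)
  rw [show β = 0 from h.elim _ _, Ext.zero_comp]
  rfl

lemma ext_eq_zero_of_comp_extClass_eq_zero {N M : ModuleCat.{u} R} {x : R}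
    (hx : IsSMulRegular M x) {i : ℕ} (h : Subsingleton (Ext N M i))
    (α : Ext N (ModuleCat.of R (QuotSMulTop x M)) i)
    (hα : α.comp hx.smulShortComplex_shortExact.extClass rfl = 0) : α = 0 := by
  obtain ⟨β, rfl⟩ := Ext.covariant_sequence_exact₃ N hx.smulShortComplex_shortExact α rfl hα
  rw [show β = 0 from h.elim _ _, Ext.zero_comp]
  rfl

lemma nontrivial_ext_quotSMulTop {N M : ModuleCat.{u} R} {x : R}
    (hx : IsSMulRegular M x) (hN : x ∈ Module.annihilator R N) {i : ℕ}
    (h : Nontrivial (Ext N M (i + 1))) :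
    Nontrivial (Ext N (ModuleCat.of R (QuotSMulTop x M)) i) := by
  by_contra hs
  rw [not_nontrivial_iff_subsingleton] at hs
  refine not_subsingleton (Ext N M (i + 1)) (subsingleton_of_forall_eq 0 fun α => ?_)
  obtain ⟨β, rfl⟩ := Ext.covariant_sequence_exact₁ N hx.smulShortComplex_shortExact α (by
    have : α.comp (Ext.mk₀ (x • 𝟙 M)) (add_zero (i + 1)) = 0 := by
      rw [Ext.mk₀_smul, Ext.comp_smul, Ext.comp_mk₀_id]
      exact smul_ext_eq_zero_of_mem_annihilator hN α
    rwa [← smulShortComplex_f_eq_smul_id] at this) (n₀ := i) rfl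
  rw [show β = 0 from hs.elim _ _, Ext.zero_comp]
  rfl

lemma exists_nontrivial_ext_of_quotSMulTop {N M : ModuleCat.{u} R} {x : R}
    (hx : IsSMulRegular M x) {i : ℕ}
    (h : Nontrivial (Ext N (ModuleCat.of R (QuotSMulTop x M)) i)) :
    ∃ j ≤ i + 1, Nontrivial (Ext N M j) := by
  by_contra! hs
  exact not_subsingleton _ (subsingleton_ext_quotSMulTop hx (hs i (by omega)) (hs (i + 1) le_rfl))

/-- `I ^ n` annihilates `Ext^i(R ⧸ I ^ t, M)` for all `t`. -/
def PowKillsExt (I : Ideal R) (n : ℕ) (M : ModuleCat.{u} R) (i : ℕ) : Prop :=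
  ∀ t, ∀ r ∈ I ^ n, ∀ α : Ext (ModuleCat.of R (R ⧸ I ^ t)) M i, r • α = 0

lemma PowKillsExt.quotSMulTop {I : Ideal R} {n : ℕ} {M : ModuleCat.{u} R} {i : ℕ}
    (h : PowKillsExt I n M (i + 1)) {x : R} (hx : IsSMulRegular M x)
    (hi : ∀ t, Subsingleton (Ext (ModuleCat.of R (R ⧸ I ^ t)) M i)) :
    PowKillsExt I n (ModuleCat.of R (QuotSMulTop x M)) i := by
  intro t r hr α
  refine ext_eq_zero_of_comp_extClass_eq_zero hx (hi t) _ ?_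
  exact (Ext.smul_comp α _ rfl r).trans (h t r hr _)

lemma PowKillsExt.smul_eq_zero {I : Ideal R} {n : ℕ} {M : ModuleCat.{u} R}
    (h : PowKillsExt I n M 0) {t : ℕ} {z : M} (hz : ∀ a ∈ I ^ t, a • z = 0) {r : R}
    (hr : r ∈ I ^ n) : r • z = 0 := by
  let f : (R ⧸ I ^ t) →ₗ[R] M := Submodule.liftQ _ (LinearMap.toSpanSingleton R M z) hz
  have h1 := h t r hr (Ext.mk₀ (ModuleCat.ofHom f))
  rw [← Ext.mk₀_smul, Ext.mk₀_eq_zero_iff] at h1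
  have h2 := congr($h1 (Submodule.Quotient.mk 1))
  have h3 : r • f (Submodule.Quotient.mk 1) = 0 := h2
  rw [← one_smul R z]
  exact h3

end ModuleCat

/-- Localization commutes with forming `M ⧸ xM`. -/
noncomputable def LocalizedModule.quotSMulTopEquiv (S : Submonoid R) (x : R) (M : Type*)
    [AddCommGroup M] [Module R M] :
    QuotSMulTop (algebraMap R (Localization S) x) (LocalizedModule S M) ≃ₗ[Localization S]
      LocalizedModule S (QuotSMulTop x M) :=
  Submodule.quotEquivOfEq _ _ (by
    ext z
    rw [Submodule.mem_smul_pointwise_iff_exists, Submodule.mem_localized']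
    constructor
    · rintro ⟨y, -, rfl⟩
      induction y using LocalizedModule.induction_on with | h m s =>
      exact ⟨x • m, Submodule.smul_mem_pointwise_smul _ _ _ trivial, s, by
        rw [algebraMap_smul, LocalizedModule.smul'_mk, IsLocalizedModule.mk_eq_mk']⟩
    · rintro ⟨m, hm, s, rfl⟩
      obtain ⟨m, -, rfl⟩ := hm
      exact ⟨LocalizedModule.mk m s, trivial, by
        rw [algebraMap_smul, LocalizedModule.smul'_mk, IsLocalizedModule.mk_eq_mk']; rfl⟩) ≪≫ₗ
    localizedQuotientEquiv S (x • (⊤ : Submodule R M))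

open Module in
lemma Module.supportDim_localized_quotSMulTop_add_one [IsNoetherianRing R] {M : Type*}
    [AddCommGroup M] [Module R M] [Module.Finite R M] (p : Ideal R) [p.IsPrime] {x : R} (hx : IsSMulRegular M x)
    (hxp : x ∈ p) :
    supportDim (Localization.AtPrime p) (LocalizedModule p.primeCompl (QuotSMulTop x M)) + 1 =
      supportDim (Localization.AtPrime p) (LocalizedModule p.primeCompl M) := by
  rw [← supportDim_eq_of_equiv (LocalizedModule.quotSMulTopEquiv p.primeCompl x M)]
  exact supportDim_quotSMulTop_succ_eq_supportDim
    (IsSMulRegular.of_isLocalizedModule _ p.primeCompl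
      (LocalizedModule.mkLinearMap p.primeCompl M) hx)
    ((IsLocalization.AtPrime.to_map_mem_maximal_iff _ p _).mpr hxp)

lemma Module.exists_smul_pow_mem_annihilator_of_supportDim_le_zero [IsNoetherianRing R] {M : Type*}
    [AddCommGroup M] [Module R M] [Module.Finite R M] (p : Ideal R) [p.IsPrime]
    (hdim : supportDim (Localization.AtPrime p) (LocalizedModule p.primeCompl M) ≤ 0) {I : Ideal R}
    (hI : I ≤ p) : ∃ n : ℕ, ∃ s ∉ p, ∀ a ∈ I ^ n, ∀ m : M, s • a • m = 0 := by
  let A := Module.annihilator (Localization.AtPrime p) (LocalizedModule p.primeCompl M)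
  have hrad : I ≤ (A.comap (algebraMap R (Localization.AtPrime p))).radical := by
    intro a ha
    rw [← Ideal.comap_radical, Ideal.mem_comap, Ideal.radical_eq_sInf, Submodule.mem_sInf]
    rintro Q ⟨hAQ, hQ⟩
    have h1 : (⟨Q, hQ⟩ : PrimeSpectrum (Localization.AtPrime p)) ∈ Module.support
      (Localization.AtPrime p) (LocalizedModule p.primeCompl M) :=
        Module.mem_support_iff_of_finite.mpr hAQ
    have hle : (⟨Q, hQ⟩ : PrimeSpectrum (Localization.AtPrime p)) ≤ IsLocalRing.closedPoint _ :=
      IsLocalRing.le_maximalIdeal hQ.ne_top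
    have h2 := Module.mem_support_mono hle h1
    have h3 :=
      (Order.krullDim_nonpos_iff_forall_isMax.mp hdim (⟨_, h1⟩ : Module.support _ _))
        (show _ ≤ (⟨_, h2⟩ : Module.support _ _) from hle)
    exact h3 ((IsLocalization.AtPrime.to_map_mem_maximal_iff _ p _).mpr (hI ha))
  obtain ⟨n, hn⟩ := Ideal.exists_pow_le_of_le_radical_of_fg hrad (IsNoetherian.noetherian I)
  refine ⟨n, ?_⟩
  let N : Submodule R M := I ^ n • ⊤
  have hp : (⟨p, ‹_›⟩ : PrimeSpectrum R) ∉ Module.support R N := by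
    rw [Module.notMem_support_iff']
    suffices h : N ≤ LinearMap.ker (LocalizedModule.mkLinearMap p.primeCompl M) by
      rintro ⟨m, hm⟩
      obtain ⟨s, hs⟩ := (IsLocalizedModule.eq_zero_iff p.primeCompl _).mp (h hm)
      exact ⟨s, s.2, Subtype.ext hs⟩
    refine Submodule.smul_le.mpr fun a ha m _ => ?_
    have := Module.mem_annihilator.mp (hn ha) (LocalizedModule.mkLinearMap p.primeCompl M m)
    rwa [algebraMap_smul, ← map_smul] at this
  rw [Module.mem_support_iff_of_finite] at hp
  obtain ⟨s, hs, hsp⟩ := SetLike.not_le_iff_exists.mp hp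
  refine ⟨s, hsp, fun a ha m => ?_⟩
  exact congrArg Subtype.val (Module.mem_annihilator.mp hs
    (⟨a • m, Submodule.smul_mem_smul ha trivial⟩ : N))

lemma QuotSMulTop.mem_annihilator_iff {M : Type*} [AddCommGroup M] [Module R M] {x r : R} :
    r ∈ Module.annihilator R (QuotSMulTop x M) ↔ ∀ z : M, ∃ y : M, x • y = r • z := by
  rw [Module.mem_annihilator, (Submodule.mkQ_surjective (x • (⊤ : Submodule R M))).forall]
  refine forall_congr' fun z => ?_
  rw [← map_smul, Submodule.mkQ_apply, Submodule.Quotient.mk_eq_zero,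
    Submodule.mem_smul_pointwise_iff_exists]
  simp

lemma QuotSMulTop.annihilator_pow_le {M : Type*} [AddCommGroup M] [Module R M] (x : R) (m : ℕ) :
    Module.annihilator R (QuotSMulTop x M) ^ m ≤ Module.annihilator R (QuotSMulTop (x ^ m) M) := by
  induction m with
  | zero =>
    intro r _
    exact QuotSMulTop.mem_annihilator_iff.mpr fun z => ⟨r • z, by simp⟩
  | succ m ih =>
    rw [pow_succ, Ideal.mul_le]
    intro r hr s hs
    refine QuotSMulTop.mem_annihilator_iff.mpr fun z => ?_
    obtain ⟨y, hy⟩ := QuotSMulTop.mem_annihilator_iff.mp hs z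
    obtain ⟨w, hw⟩ := QuotSMulTop.mem_annihilator_iff.mp (ih hr) y
    exact ⟨w, by rw [mul_smul, ← hy, pow_succ', mul_smul, hw, smul_comm]⟩

namespace ModuleCat
variable [IsNoetherianRing R]

lemma PowKillsExt.not_supportDim_le_one {I : Ideal R} {n : ℕ} {M : ModuleCat.{u} R}
    [Module.Finite R M]
    (h : PowKillsExt I n M 1) {p : PrimeSpectrum R} (hp : p ∈ Module.support R M)
    (hI : I ≤ p.asIdeal) {x : R} (hxI : x ∈ I) (hx : IsSMulRegular M x)
    (hi : ∀ t, Subsingleton (Ext (ModuleCat.of R (R ⧸ I ^ t)) M 0))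
    (hdim : Module.supportDim (Localization.AtPrime p.asIdeal)
      (LocalizedModule p.asIdeal.primeCompl (QuotSMulTop x M)) ≤ 0) : False := by
  obtain ⟨T, s, hs, hT⟩ := Module.exists_smul_pow_mem_annihilator_of_supportDim_le_zero _ hdim hI
  have hsT : Ideal.span {s} * I ^ T ≤ Module.annihilator R (QuotSMulTop x M) := by
    rw [Ideal.span_singleton_mul_le_iff]
    intro a ha
    exact Module.mem_annihilator.mpr fun m => by rw [mul_smul, hT a ha]
  have hsm : s ^ (n + 1) ∈ Module.annihilator R (QuotSMulTop x M) := by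
    rw [QuotSMulTop.mem_annihilator_iff]
    intro z
    have hkill := (h.quotSMulTop (hx.pow (n + 1)) hi).smul_eq_zero (t := T * (n + 1))
      (z := Submodule.Quotient.mk (s ^ (n + 1) • z)) (fun a ha => by
        have := QuotSMulTop.annihilator_pow_le x (n + 1) (Ideal.pow_right_mono hsT (n + 1)
          (show s ^ (n + 1) * a ∈ _ by
            rw [mul_pow, ← pow_mul]
            exact Ideal.mul_mem_mul (Ideal.pow_mem_pow (Ideal.mem_span_singleton_self s) _) ha))
        have h2 := Module.mem_annihilator.mp this (Submodule.Quotient.mk z)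
        rwa [mul_comm, mul_smul] at h2) (Ideal.pow_mem_pow hxI n)
    rw [← Submodule.Quotient.mk_smul, Submodule.Quotient.mk_eq_zero,
      Submodule.mem_smul_pointwise_iff_exists] at hkill
    obtain ⟨y, -, hy⟩ := hkill
    refine ⟨y, hx.pow n ?_⟩
    dsimp only
    rw [← hy, pow_succ, mul_smul]
  have hp' : p ∈ Module.support R (QuotSMulTop x M) := by
    rw [Module.support_quotSMulTop]
    exact ⟨hp, by simpa using hI hxI⟩
  exact hs (p.2.mem_of_pow_mem _ (Module.annihilator_le_of_mem_support hp' hsm))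

lemma subsingleton_ext_quotient_pow {I : Ideal R} {n : ℕ} {M : ModuleCat.{u} R} [Module.Finite R M]
    {p : PrimeSpectrum R} (hp : p ∈ Module.support R M) (hI : I ≤ p.asIdeal)
    (h : ∀ i < n, Subsingleton (Ext (ModuleCat.of R (R ⧸ I)) M i)) (t : ℕ) :
    ∀ i < n, Subsingleton (Ext (ModuleCat.of R (R ⧸ I ^ t)) M i) :=
  subsingleton_ext_of_support_subset (Module.smul_top_lt_top_of_mem_support hp hI) h _
    (support_quotient_pow_subset I t)

lemma PowKillsExt.not_supportDim_le {I : Ideal R} {n : ℕ} {p : PrimeSpectrum R} (hI : I ≤ p.asIdeal)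
    (g : ℕ) (M : ModuleCat.{u} R) [Module.Finite R M] (hp : p ∈ Module.support R M)
    (hi : ∀ i < g + 1, Subsingleton (Ext (ModuleCat.of R (R ⧸ I)) M i))
    (hdim : Module.supportDim (Localization.AtPrime p.asIdeal)
      (LocalizedModule p.asIdeal.primeCompl M) ≤ (g + 1 : ℕ))
    (h : PowKillsExt I n M (g + 1)) : False := by
  induction g generalizing M with
  | zero =>
    obtain ⟨x, hxI, hx⟩ := exists_isSMulRegular_of_subsingleton_ext_zero (hi 0 (by omega))
    refine h.not_supportDim_le_one hp hI hxI hx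
      (fun t => subsingleton_ext_quotient_pow hp hI hi t 0 (by omega)) ?_
    rw [← Module.supportDim_localized_quotSMulTop_add_one _ hx (hI hxI)] at hdim
    exact (ENat.WithBot.add_le_add_one_right_iff).mp hdim
  | succ g ih =>
    obtain ⟨x, hxI, hx⟩ := exists_isSMulRegular_of_subsingleton_ext_zero (hi 0 (by omega))
    have hp' : p ∈ Module.support R (QuotSMulTop x M) := by
      rw [Module.support_quotSMulTop]
      exact ⟨hp, by simpa using hI hxI⟩
    refine ih (ModuleCat.of R (QuotSMulTop x M)) hp'
      (fun i h => subsingleton_ext_quotSMulTop hx (hi i (by omega)) (hi (i + 1) (by omega))) ?_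
      (h.quotSMulTop hx (fun t => subsingleton_ext_quotient_pow hp hI hi t _ (by omega)))
    rw [← Module.supportDim_localized_quotSMulTop_add_one _ hx (hI hxI)] at hdim
    exact (ENat.WithBot.add_le_add_one_right_iff).mp hdim

lemma exists_nontrivial_ext_residueField {I : Ideal R} (g : ℕ) (M : ModuleCat.{u} R)
    [Module.Finite R M]
    (hi : ∀ i < g, Subsingleton (Ext (ModuleCat.of R (R ⧸ I)) M i))
    (hg : Nontrivial (Ext (ModuleCat.of R (R ⧸ I)) M g)) :
    ∃ p ∈ Module.support R M, I ≤ p.asIdeal ∧ ∃ j ≤ g, Nontrivial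
      (Ext (ModuleCat.of (Localization.AtPrime p.asIdeal) (Localization.AtPrime p.asIdeal ⧸
        IsLocalRing.maximalIdeal (Localization.AtPrime p.asIdeal)))
        (ModuleCat.of (Localization.AtPrime p.asIdeal)
          (LocalizedModule p.asIdeal.primeCompl M)) j) := by
  induction g generalizing M with
  | zero =>
    have : Nontrivial ((R ⧸ I) →ₗ[R] M) :=
      ((Ext.addEquiv₀ (X := ModuleCat.of R (R ⧸ I))).trans ModuleCat.homAddEquiv).symm.nontrivial
    obtain ⟨f, hf⟩ := exists_ne (0 : (R ⧸ I) →ₗ[R] M)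
    have hf1 : f (Ideal.Quotient.mk I 1) ≠ 0 := fun h => hf (by ext; exact h)
    obtain ⟨P, hP, hle⟩ := exists_le_isAssociatedPrime_of_isNoetherianRing R _ hf1
    have hIP : I ≤ P := fun r hr => hle <| by
      rw [Submodule.mem_colon_singleton, Submodule.mem_bot, ← map_smul, map_one,
        Algebra.smul_def, Ideal.Quotient.algebraMap_eq, Ideal.Quotient.eq_zero_iff_mem.mpr hr,
        zero_mul, map_zero]
    obtain ⟨hPp, y, hy⟩ := isAssociatedPrime_iff.mp hP
    let S := P.primeCompl
    let y' : LocalizedModule S M := LocalizedModule.mkLinearMap S M y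
    have hy' : y' ≠ 0 := fun h => by
      obtain ⟨s, hs⟩ := (IsLocalizedModule.eq_zero_iff S (LocalizedModule.mkLinearMap S M)).mp h
      refine s.2 ?_
      have : (s : R) ∈ (⊥ : Submodule R M).colon {y} := by
        rw [Submodule.mem_colon_singleton, Submodule.mem_bot]
        exact hs
      rwa [← hy] at this
    refine ⟨⟨P, hPp⟩, ?_, hIP, 0, le_rfl, ?_⟩
    · rw [Module.mem_support_iff]
      exact nontrivial_of_ne _ _ hy'
    have hker : IsLocalRing.maximalIdeal (Localization.AtPrime P) ≤
        LinearMap.ker (LinearMap.toSpanSingleton (Localization.AtPrime P) _ y') := by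
      rw [← Localization.AtPrime.map_eq_maximalIdeal, Ideal.map_le_iff_le_comap]
      intro r hr
      rw [Ideal.mem_comap, LinearMap.mem_ker, LinearMap.toSpanSingleton_apply, algebraMap_smul]
      rw [hy, Submodule.mem_colon_singleton, Submodule.mem_bot] at hr
      rw [← map_smul, hr, map_zero]
    let φ := Submodule.liftQ _ _ hker
    refine nontrivial_of_ne (Ext.mk₀ (ModuleCat.ofHom φ)) 0 fun h => hy' ?_
    rw [Ext.mk₀_eq_zero_iff] at h
    have := LinearMap.congr_fun (congrArg ModuleCat.Hom.hom h) (Submodule.Quotient.mk 1)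
    rw [ModuleCat.hom_ofHom, Submodule.liftQ_apply, LinearMap.toSpanSingleton_apply, one_smul]
      at this
    exact this
  | succ g ih =>
    obtain ⟨x, hxI, hx⟩ := exists_isSMulRegular_of_subsingleton_ext_zero (hi 0 (by omega))
    obtain ⟨p, hp, hIp, j, hj, hne⟩ := ih (ModuleCat.of R (QuotSMulTop x M))
      (fun i h => subsingleton_ext_quotSMulTop hx (hi i (by omega)) (hi (i + 1) (by omega)))
      (nontrivial_ext_quotSMulTop hx (by rwa [Ideal.annihilator_quotient]) hg)
    have hp' : p ∈ Module.support R M := by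
      rw [Module.support_quotSMulTop] at hp
      exact hp.1
    have hx' : IsSMulRegular (LocalizedModule p.asIdeal.primeCompl M)
      (algebraMap R (Localization.AtPrime p.asIdeal) x) := IsSMulRegular.of_isLocalizedModule _
        p.asIdeal.primeCompl (LocalizedModule.mkLinearMap p.asIdeal.primeCompl M) hx
    let e := (LocalizedModule.quotSMulTopEquiv p.asIdeal.primeCompl x M).symm.toModuleIso
    have hne' : Nontrivial (Ext (ModuleCat.of _ (Localization.AtPrime p.asIdeal ⧸
        IsLocalRing.maximalIdeal (Localization.AtPrime p.asIdeal)))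
        (ModuleCat.of (Localization.AtPrime p.asIdeal)
        (QuotSMulTop (algebraMap R (Localization.AtPrime p.asIdeal) x)
          (LocalizedModule p.asIdeal.primeCompl M))) j) := by
      obtain ⟨α, hα⟩ := @exists_ne _ hne 0
      refine nontrivial_of_ne (α.comp (Ext.mk₀ e.hom) (add_zero j)) 0 fun h => hα ?_
      simpa using congr($(h).comp (Ext.mk₀ e.inv) (add_zero j))
    obtain ⟨k, hk, hne''⟩ := exists_nontrivial_ext_of_quotSMulTop
      (M := ModuleCat.of (Localization.AtPrime p.asIdeal)
          (LocalizedModule p.asIdeal.primeCompl M)) hx' hne'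
    exact ⟨p, hp', hIp, k, by omega, hne''⟩

end ModuleCat

end

noncomputable section

open Limits ModuleCat

variable {R : Type u} [CommRing R]

namespace localCohomology

variable (I : Ideal R) (M : ModuleCat.{u} R) (i : ℕ)

/-- The diagram of modules `Ext^i(R/I^t, M)` computing `H^i_I(M)`. -/
def extDiagram : (ℕᵒᵖ)ᵒᵖ ⥤ ModuleCat.{u} R :=
  diagram (idealPowersDiagram I) i ⋙ (evaluation _ _).obj M

/-- The cocone over `extDiagram` with point `H^i_I(M)`. -/
def extCocone : Cocone (extDiagram I M i) :=
  ((evaluation _ _).obj M).mapCocone (colimit.cocone (diagram (idealPowersDiagram I) i))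

/-- `H^i_I(M)` is the colimit of `extDiagram`. -/
def isColimitExtCocone : IsColimit (extCocone I M i) :=
  isColimitOfPreserves ((evaluation _ _).obj M) (colimit.isColimit _)

instance : PreservesColimitsOfShape (ℕᵒᵖ)ᵒᵖ (forget (ModuleCat.{u} R)) :=
  have := preservesSmallestFilteredColimits_of_preservesFilteredColimits (forget (ModuleCat.{u} R))
  inferInstance

/-- The projection `R ⧸ I ^ t ⟶ R ⧸ I ^ s` for `s ≤ t`. -/
def quotientPowMap {s t : ℕ} (h : s ≤ t) :
    ModuleCat.of R (R ⧸ I ^ t) ⟶ ModuleCat.of R (R ⧸ I ^ s) :=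
  (ringModIdeals (idealPowersDiagram I)).map (homOfLE h).op

/-- The structure map `Ext^i(R/I^t, M) → H^i_I(M)`. -/
def ofExt (t : ℕ) : Abelian.Ext (ModuleCat.of R (R ⧸ I ^ t)) M i →ₗ[R]
    (localCohomology I i).obj M :=
  ((extCocone I M i).ι.app (op (op t))).hom ∘ₗ
    ((CategoryTheory.projectiveResolution
      (ModuleCat.of R (R ⧸ I ^ t))).extLinearEquiv M i).symm.toLinearMap

lemma exists_ofExt_eq (z : (localCohomology I i).obj M) : ∃ t α, ofExt I M i t α = z := by
  obtain ⟨⟨⟨t⟩⟩, y, hy⟩ := Concrete.isColimit_exists_rep _ (isColimitExtCocone I M i) z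
  refine ⟨t, (CategoryTheory.projectiveResolution (ModuleCat.of R (R ⧸ I ^ t))).extLinearEquiv M i y,
    ?_⟩
  exact (congrArg ((extCocone I M i).ι.app (op (op t)))
    (LinearEquiv.symm_apply_apply _ y)).trans hy

lemma exists_mk₀_comp_eq_zero {t : ℕ} {α} (h : ofExt I M i t α = 0) :
    ∃ (t' : ℕ) (h : t ≤ t'), (Abelian.Ext.mk₀ (quotientPowMap I h)).comp α (zero_add i) = 0 := by
  let P (t : ℕ) := CategoryTheory.projectiveResolution (ModuleCat.of R (R ⧸ I ^ t))
  let y : (extDiagram I M i).obj (op (op t)) := ((P t).extLinearEquiv M i).symm α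
  obtain ⟨⟨⟨t'⟩⟩, f, k, hf⟩ := (Concrete.isColimit_rep_eq_iff_exists _ (isColimitExtCocone I M i)
    (i := op (op t)) (j := op (op t)) y 0).mp (h.trans (map_zero _).symm)
  refine ⟨t', leOfHom f.unop.unop, ?_⟩
  have := (P t').extLinearEquiv_naturality (P t) (quotientPowMap I (leOfHom f.unop.unop)) M i y
  rw [LinearEquiv.apply_symm_apply] at this
  rw [← this]
  refine (LinearEquiv.map_eq_zero_iff _).mpr ?_
  exact hf.trans (map_zero _)

lemma subsingleton_of_subsingleton_ext
    (h : ∀ t, Subsingleton (Abelian.Ext (ModuleCat.of R (R ⧸ I ^ t)) M i)) :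
    Subsingleton ((localCohomology I i).obj M) :=
  subsingleton_of_forall_eq 0 fun z => by
    obtain ⟨t, α, rfl⟩ := exists_ofExt_eq I M i z
    rw [(h t).elim α 0, map_zero]

variable {I M i}

lemma exists_pow_smul_eq_zero [IsNoetherianRing R]
    (hfin : Module.Finite R ((localCohomology I i).obj M)) :
    ∃ n, ∀ r ∈ I ^ n, ∀ z : (localCohomology I i).obj M, r • z = 0 := by
  have hloc (z : (localCohomology I i).obj M) : ∃ n, ∀ r ∈ I ^ n, r • z = 0 := by
    obtain ⟨t, α, rfl⟩ := exists_ofExt_eq I M i z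
    refine ⟨t, fun r hr => ?_⟩
    rw [← map_smul, smul_ext_eq_zero_of_mem_annihilator (by rwa [Ideal.annihilator_quotient]),
      map_zero]
  obtain ⟨s, hs⟩ := hfin.fg_top
  choose n hn using hloc
  refine ⟨s.sup n, fun r hr z => ?_⟩
  have hz : z ∈ Submodule.span R (s : Set ((localCohomology I i).obj M)) := hs ▸ Submodule.mem_top
  induction hz using Submodule.span_induction with
  | mem z hz => exact hn z r (Ideal.pow_le_pow_right (Finset.le_sup hz) hr)
  | zero => exact smul_zero r
  | add x y _ _ hx hy => rw [smul_add, hx, hy, add_zero]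
  | smul a x _ hx => rw [smul_comm, hx, smul_zero]

lemma ofExt_injective [IsNoetherianRing R] [Module.Finite R M] (hM : I • (⊤ : Submodule R M) < ⊤)
    (h : ∀ j < i, Subsingleton (Abelian.Ext (ModuleCat.of R (R ⧸ I)) M j)) (t : ℕ) :
    Function.Injective (ofExt I M i t) := by
  refine (injective_iff_map_eq_zero _).mpr fun α hα => ?_
  obtain ⟨t', htt', hα⟩ := exists_mk₀_comp_eq_zero I M i hα
  let f := quotientPowMap I htt'
  have hf : Function.Surjective f := Submodule.factor_surjective (Ideal.pow_le_pow_right htt')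
  have : Epi f := (ModuleCat.epi_iff_surjective f).mpr hf
  let S := ShortComplex.mk (kernel.ι f) f (kernel.condition f)
  have hS : S.ShortExact := { exact := ShortComplex.exact_kernel f }
  obtain ⟨j, rfl⟩ | rfl : (∃ j, i = 1 + j) ∨ i = 0 := by
    rcases i with _ | j
    · exact .inr rfl
    · exact .inl ⟨j, add_comm _ _⟩
  · obtain ⟨β, rfl⟩ := Abelian.Ext.contravariant_sequence_exact₃ hS M α hα (n₀ := j) rfl
    have hinj : Function.Injective (kernel.ι f) := (ModuleCat.mono_iff_injective _).mp inferInstance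
    have : Module.Finite R ((kernel f : ModuleCat.{u} R)) :=
      Module.Finite.of_injective (kernel.ι f).hom hinj
    have := subsingleton_ext_of_support_subset hM h (kernel f)
      ((Module.support_subset_of_injective (kernel.ι f).hom hinj).trans
        (support_quotient_pow_subset I t')) j (by omega)
    rw [Subsingleton.elim β 0, Abelian.Ext.comp_zero]
  · obtain ⟨g, rfl⟩ := (Abelian.Ext.mk₀_bijective _ M).surjective α
    rw [Abelian.Ext.mk₀_comp_mk₀, Abelian.Ext.mk₀_eq_zero_iff] at hα
    rw [Abelian.Ext.mk₀_eq_zero_iff]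
    exact (cancel_epi f).mp (hα.trans comp_zero.symm)

lemma powKillsExt [IsNoetherianRing R] [Module.Finite R M]
    (hM : I • (⊤ : Submodule R M) < ⊤)
    (h : ∀ j < i, Subsingleton (Abelian.Ext (ModuleCat.of R (R ⧸ I)) M j))
    (hfin : Module.Finite R ((localCohomology I i).obj M)) : ∃ n, PowKillsExt I n M i := by
  obtain ⟨n, hn⟩ := exists_pow_smul_eq_zero hfin
  refine ⟨n, fun t r hr α => ofExt_injective hM h t ?_⟩
  rw [map_smul, hn r hr, map_zero]

end localCohomology

end

lemma moduleDepth_le {R : Type u} [CommRing R] [IsLocalRing R] {M : Type u} [AddCommGroup M]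
    [Module R M] {j : ℕ}
    (h : Nontrivial (Abelian.Ext (ModuleCat.of R (R ⧸ IsLocalRing.maximalIdeal R))
      (ModuleCat.of R M) j)) : moduleDepth R M ≤ j :=
  sInf_le ⟨j, rfl, ((projectiveResolution _).extLinearEquiv _ j).toEquiv.nontrivial⟩

theorem finiteness_dim_eq_grade_of_cohenMacaulay
    {R : Type u} [CommRing R] [IsNoetherianRing R]
    (𝔞 : Ideal R) (M : Type u) [AddCommGroup M] [Module R M] [Module.Finite R M] [Nontrivial M]
    (h_CM : ∀ 𝔭 ∈ Module.support R M,
      (moduleDepth (Localization.AtPrime 𝔭.asIdeal)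
          (LocalizedModule 𝔭.asIdeal.primeCompl M) : WithBot ℕ∞) =
        moduleKrullDim (Localization.AtPrime 𝔭.asIdeal) (LocalizedModule 𝔭.asIdeal.primeCompl M))
    (h_pos : 0 < moduleHeight R M 𝔞) (h_fin : moduleHeight R M 𝔞 < ⊤)
    (g : ℕ)
    (h_grade_mem : Nontrivial
      (((Ext R (ModuleCat.{u} R) g).obj (op (ModuleCat.of R (R ⧸ 𝔞)))).obj (ModuleCat.of R M)))
    (h_grade_min : ∀ i < g, Subsingleton
      (((Ext R (ModuleCat.{u} R) i).obj (op (ModuleCat.of R (R ⧸ 𝔞)))).obj (ModuleCat.of R M))) :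
    (∀ i < g, Module.Finite R ((localCohomology 𝔞 i).obj (ModuleCat.of R M))) ∧
      ¬ Module.Finite R ((localCohomology 𝔞 g).obj (ModuleCat.of R M)) := by
  have e (i : ℕ) := (projectiveResolution (ModuleCat.of R (R ⧸ 𝔞))).extLinearEquiv
    (ModuleCat.of R M) i
  have hg : Nontrivial (Abelian.Ext (ModuleCat.of R (R ⧸ 𝔞)) (ModuleCat.of R M) g) :=
    (e g).symm.toEquiv.nontrivial
  have hmin (i : ℕ) (hi : i < g) :
      Subsingleton (Abelian.Ext (ModuleCat.of R (R ⧸ 𝔞)) (ModuleCat.of R M) i) :=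
    have := h_grade_min i hi
    (e i).symm.toEquiv.subsingleton
  have : Module.Finite R (ModuleCat.of R M) := ‹Module.Finite R M›
  obtain ⟨p, hp, hap, j, hj, hne⟩ := ModuleCat.exists_nontrivial_ext_residueField g _ hmin hg
  refine ⟨fun i hi => ?_, fun hfin => ?_⟩
  · have := localCohomology.subsingleton_of_subsingleton_ext 𝔞 (ModuleCat.of R M) i fun t =>
      ModuleCat.subsingleton_ext_quotient_pow hp hap hmin t i hi
    infer_instance
  obtain ⟨n, hn⟩ := localCohomology.powKillsExt
    (Module.smul_top_lt_top_of_mem_support hp hap) hmin hfin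
  have hdim : Module.supportDim (Localization.AtPrime p.asIdeal)
      (LocalizedModule p.asIdeal.primeCompl M) ≤ (g : ℕ) := by
    refine (h_CM p hp).symm.trans_le ?_
    exact_mod_cast (moduleDepth_le hne).trans (Nat.cast_le.mpr hj)
  have hpos : 0 < Module.supportDim (Localization.AtPrime p.asIdeal)
      (LocalizedModule p.asIdeal.primeCompl M) :=
    h_pos.trans_le (sInf_le ⟨p, hp, hap, rfl⟩)
  obtain _ | g := g
  · exact (hpos.trans_le hdim).false
  · exact hn.not_supportDim_le hap g _ hp hmin hdim
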